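/- For every ribbonless graph H and disjoint subsets M and C of its node set, the graph α_RG(H;M,C) generated by the RG-generating algorithm is a ribbonless graph. -/

import Mathlib

/-!
Stable mixed graphs: mixed graphs with arrows, arcs and lines; ribbonless,
summary and ancestral graphs; the generating maps α_RG, α_SG, α_AG;
m-connecting paths, m-separation and induced independence models.
-/

namespace StableMixedGraphs

/-- A mixed graph on node type `V`: a node set together with three edge
relations: arrows (`arrow i j` means an arrow from `i` to `j`), arcs
(two-headed, symmetric) and lines (undirected, symmetric). -/
structure MixedGraph (V : Type) where
  nodes : Set V
  arrow : V → V → Prop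
  arc : V → V → Prop
  line : V → V → Prop

namespace MixedGraph

variable {V W : Type}

/-- Wellformedness: arcs and lines are symmetric relations and all edges join
nodes of the graph. -/
def Wf (G : MixedGraph V) : Prop :=
  (∀ i j, G.arc i j → G.arc j i) ∧
  (∀ i j, G.line i j → G.line j i) ∧
  (∀ i j, G.arrow i j ∨ G.arc i j ∨ G.line i j → i ∈ G.nodes ∧ j ∈ G.nodes)

/-- No loops of any of the three kinds. -/
def Loopless (G : MixedGraph V) : Prop :=
  ∀ i, ¬ G.arrow i i ∧ ¬ G.arc i i ∧ ¬ G.line i i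

/-- A loopless mixed graph with a finite node set. -/
def IsLMG (G : MixedGraph V) : Prop := G.Wf ∧ G.Loopless ∧ G.nodes.Finite

/-- `G.anc i j` : `i` is an ancestor of `j`, i.e. there is a
direction-preserving path from `i` to `j`. -/
def anc (G : MixedGraph V) (i j : V) : Prop := Relation.TransGen G.arrow i j

/-- The set of ancestors of nodes of `C`. -/
def anSet (G : MixedGraph V) (C : Set V) : Set V := {a | ∃ c ∈ C, G.anc a c}

/-- `i` lies on a direction-preserving cycle. -/
def OnDPCycle (G : MixedGraph V) (i : V) : Prop := G.anc i i

/-- `i` is an endpoint of a line. -/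
def LineEndpoint (G : MixedGraph V) (i : V) : Prop := ∃ j, G.line i j

/-- Condition (2) of a ribbon: `i` or a descendant of `i` is an endpoint of a
line or lies on a direction-preserving cycle. -/
def RibbonTail (G : MixedGraph V) (i : V) : Prop :=
  ∃ d, (d = i ∨ G.anc i d) ∧ (G.LineEndpoint d ∨ G.OnDPCycle d)

/-- `G` contains a ribbon: a collider V-configuration `⟨h,i,j⟩` with no
endpoint-identical edge between `h` and `j`, whose inner node `i` (or a
descendant of it) is an endpoint of a line or on a direction-preserving
cycle. -/
def HasRibbon (G : MixedGraph V) : Prop :=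
  ∃ h i j, h ≠ i ∧ i ≠ j ∧ h ≠ j ∧ G.RibbonTail i ∧
    ((G.arc h i ∧ G.arc i j ∧ ¬ G.arc h j) ∨
     (G.arrow h i ∧ G.arrow j i ∧ ¬ G.line h j) ∨
     (G.arrow h i ∧ G.arc i j ∧ ¬ G.arrow h j))

/-- A ribbonless graph: a loopless mixed graph with no ribbon. -/
def IsRG (G : MixedGraph V) : Prop := G.IsLMG ∧ ¬ G.HasRibbon

/-- A directed acyclic graph: only arrows, no direction-preserving cycle. -/
def IsDAG (G : MixedGraph V) : Prop :=
  G.IsLMG ∧ (∀ i j, ¬ G.arc i j) ∧ (∀ i j, ¬ G.line i j) ∧ ∀ i, ¬ G.anc i i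

/-- A summary graph: a loopless mixed graph with no arrowhead pointing to an
endpoint of a line and no direction-preserving cycle. -/
def IsSG (G : MixedGraph V) : Prop :=
  G.IsLMG ∧ (∀ i, G.LineEndpoint i → ∀ k, ¬ G.arrow k i ∧ ¬ G.arc k i) ∧
    ∀ i, ¬ G.anc i i

/-- A simple mixed graph: no loops and no multiple edges. -/
def Simple (G : MixedGraph V) : Prop :=
  G.Loopless ∧ ∀ i j,
    (G.arrow i j → ¬ G.arrow j i ∧ ¬ G.arc i j ∧ ¬ G.line i j) ∧
    (G.arc i j → ¬ G.line i j)

/-- An ancestral graph: a simple mixed graph such that no node is an ancestor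
of one of its parents or spouses, and a node with a neighbour has neither
parents nor spouses. -/
def IsAG (G : MixedGraph V) : Prop :=
  G.Wf ∧ G.Simple ∧ G.nodes.Finite ∧
  (∀ i j, G.arrow j i ∨ G.arc j i → ¬ G.anc i j) ∧
  (∀ i, G.LineEndpoint i → ∀ k, ¬ G.arrow k i ∧ ¬ G.arc k i)

/-- An undirected graph: only lines. -/
def IsUG (G : MixedGraph V) : Prop :=
  G.IsLMG ∧ (∀ i j, ¬ G.arrow i j) ∧ ∀ i j, ¬ G.arc i j

/-- A bidirected graph: only arcs. -/
def IsBG (G : MixedGraph V) : Prop :=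
  G.IsLMG ∧ (∀ i j, ¬ G.arrow i j) ∧ ∀ i j, ¬ G.line i j

/-- Image of a mixed graph under a map of node types. -/
def map (f : V → W) (G : MixedGraph V) : MixedGraph W where
  nodes := f '' G.nodes
  arrow a b := ∃ i j, G.arrow i j ∧ f i = a ∧ f j = b
  arc a b := ∃ i j, G.arc i j ∧ f i = a ∧ f j = b
  line a b := ∃ i j, G.line i j ∧ f i = a ∧ f j = b

end MixedGraph

/-! ### The closure generating new edges (Table 1 of the RG-generating
algorithm), for given marginalisation set `M` and collider set
`S = C ∪ an(C)`.  For every V-configuration whose inner node is a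
non-collider in `M` (rows 1–7) or a collider in `S` (rows 8–10) the
endpoint-identical edge between the endpoints is generated, repeatedly
until closure. -/

mutual
  /-- Generated arrows (`GenArrow H M S j i`: arrow from `j` to `i`). -/
  inductive GenArrow {V : Type} (H : MixedGraph V) (M S : Set V) : V → V → Prop
    | base {i j : V} : H.arrow i j → GenArrow H M S i j
    | row1 {i j m : V} : m ∈ M → j ≠ i →
        GenArrow H M S j m → GenArrow H M S m i → GenArrow H M S j i
    | row2 {i j m : V} : m ∈ M → j ≠ i →
        GenLine H M S j m → GenArrow H M S m i → GenArrow H M S j i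
    | row3 {i j m : V} : m ∈ M → j ≠ i →
        GenLine H M S j m → GenArc H M S m i → GenArrow H M S j i
    | row8 {i j s : V} : s ∈ S → j ≠ i →
        GenArrow H M S j s → GenArc H M S s i → GenArrow H M S j i

  /-- Generated arcs. -/
  inductive GenArc {V : Type} (H : MixedGraph V) (M S : Set V) : V → V → Prop
    | base {i j : V} : H.arc i j → GenArc H M S i j
    | symm {i j : V} : GenArc H M S i j → GenArc H M S j i
    | row4 {i j m : V} : m ∈ M → i ≠ j →
        GenArrow H M S m i → GenArrow H M S m j → GenArc H M S i j
    | row5 {i j m : V} : m ∈ M → i ≠ j →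
        GenArrow H M S m i → GenArc H M S m j → GenArc H M S i j
    | row9 {i j s : V} : s ∈ S → i ≠ j →
        GenArc H M S i s → GenArc H M S s j → GenArc H M S i j

  /-- Generated lines. -/
  inductive GenLine {V : Type} (H : MixedGraph V) (M S : Set V) : V → V → Prop
    | base {i j : V} : H.line i j → GenLine H M S i j
    | symm {i j : V} : GenLine H M S i j → GenLine H M S j i
    | row6 {i j m : V} : m ∈ M → i ≠ j →
        GenLine H M S i m → GenArrow H M S j m → GenLine H M S i j
    | row7 {i j m : V} : m ∈ M → i ≠ j →
        GenLine H M S i m → GenLine H M S m j → GenLine H M S i j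
    | row10 {i j s : V} : s ∈ S → i ≠ j →
        GenArrow H M S i s → GenArrow H M S j s → GenLine H M S i j
end

variable {V : Type}

/-- The RG-generating map `α_RG(H;M,C)`: generate all edges of the closure
and delete the nodes of `M ∪ C`. -/
def alphaRG (H : MixedGraph V) (M C : Set V) : MixedGraph V where
  nodes := H.nodes \ (M ∪ C)
  arrow i j := i ∈ H.nodes \ (M ∪ C) ∧ j ∈ H.nodes \ (M ∪ C) ∧
    GenArrow H M (C ∪ H.anSet C) i j
  arc i j := i ∈ H.nodes \ (M ∪ C) ∧ j ∈ H.nodes \ (M ∪ C) ∧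
    GenArc H M (C ∪ H.anSet C) i j
  line i j := i ∈ H.nodes \ (M ∪ C) ∧ j ∈ H.nodes \ (M ∪ C) ∧
    GenLine H M (C ∪ H.anSet C) i j

/-- The arrowhead-removal operation `α_RG.SG(K;A)`: every arrowhead pointing
at a node of `A` is removed (an arrow at such a node becomes a line, an arc
becomes an arrow, an arc with both endpoints in `A` becomes a line),
repeatedly until closure. -/
def deheadAt (K : MixedGraph V) (A : Set V) : MixedGraph V where
  nodes := K.nodes
  arrow j i := i ∉ A ∧ (K.arrow j i ∨ (K.arc j i ∧ j ∈ A))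
  arc i j := K.arc i j ∧ i ∉ A ∧ j ∉ A
  line i j := K.line i j ∨ (K.arrow j i ∧ i ∈ A) ∨ (K.arrow i j ∧ j ∈ A) ∨
    (K.arc i j ∧ i ∈ A ∧ j ∈ A)

/-- The SG-generating map `α_SG(H;M,C)`: mark the nodes of `an(C)`, apply the
RG-generating construction, then remove all arrowheads pointing at marked
nodes. -/
def alphaSG (H : MixedGraph V) (M C : Set V) : MixedGraph V :=
  deheadAt (alphaRG H M C) (H.anSet C)

/-! ### Step 2 of the AG-generating algorithm: for every V-configuration
`j → k ↔ i` or `j ↔ k ↔ i` with `k ∈ an(i)` (in the current graph) generate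
an arrow from `j` to `i`, respectively an arc between `j` and `i`, until
closure. -/

mutual
  inductive AG2Arrow {V : Type} (K : MixedGraph V) : V → V → Prop
    | base {i j : V} : K.arrow j i → AG2Arrow K j i
    | gen {i j k : V} : j ≠ i → AG2Arrow K j k → AG2Arc K k i →
        AG2Anc K k i → AG2Arrow K j i

  inductive AG2Arc {V : Type} (K : MixedGraph V) : V → V → Prop
    | base {i j : V} : K.arc i j → AG2Arc K i j
    | symm {i j : V} : AG2Arc K i j → AG2Arc K j i
    | gen {i j k : V} : j ≠ i → AG2Arc K j k → AG2Arc K k i →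
        AG2Anc K k i → AG2Arc K j i

  /-- The ancestor relation of the graph being generated in step 2. -/
  inductive AG2Anc {V : Type} (K : MixedGraph V) : V → V → Prop
    | single {i j : V} : AG2Arrow K i j → AG2Anc K i j
    | tail {i k j : V} : AG2Arrow K i k → AG2Anc K k j → AG2Anc K i j
end

/-- The graph after step 2 of the AG-generating algorithm. -/
def ag2 (K : MixedGraph V) : MixedGraph V where
  nodes := K.nodes
  arrow := AG2Arrow K
  arc := AG2Arc K
  line := K.line

/-! ### Step 3 of the AG-generating algorithm: repeatedly replace every arc
between `j` and `i` with `j ∈ an(i)` (in the current graph) by an arrow from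
`j` to `i`. -/

mutual
  inductive AG3Arrow {V : Type} (K : MixedGraph V) : V → V → Prop
    | base {i j : V} : K.arrow j i → AG3Arrow K j i
    | conv {i j : V} : K.arc j i → AG3Anc K j i → AG3Arrow K j i

  /-- The ancestor relation of the graph being generated in step 3. -/
  inductive AG3Anc {V : Type} (K : MixedGraph V) : V → V → Prop
    | single {i j : V} : AG3Arrow K i j → AG3Anc K i j
    | tail {i k j : V} : AG3Arrow K i k → AG3Anc K k j → AG3Anc K i j
end

/-- Steps 2 and 3 of the AG-generating algorithm, applied to a summary
graph: `α_SG.AG`. -/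
def alphaSGAG (K : MixedGraph V) : MixedGraph V :=
  let K2 := ag2 K
  { nodes := K.nodes
    arrow := AG3Arrow K2
    arc := fun i j => K2.arc i j ∧ ¬ AG3Anc K2 i j ∧ ¬ AG3Anc K2 j i
    line := K.line }

/-- The AG-generating map `α_AG(H;M,C)`. -/
def alphaAG (H : MixedGraph V) (M C : Set V) : MixedGraph V :=
  alphaSGAG (alphaSG H M C)

/-! ### Paths, m-connection and m-separation. -/

/-- A step of a walk: it goes from `src` to `tgt` along an edge which has an
arrowhead at `src` iff `hs = true` and an arrowhead at `tgt` iff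
`ht = true` (so `hs = ht = false` is a line, `hs = ht = true` an arc, and
exactly one head an arrow in the corresponding direction). -/
structure Step (V : Type) where
  src : V
  tgt : V
  hs : Bool
  ht : Bool

/-- The edge of a step is present in `G`. -/
def Step.valid (G : MixedGraph V) (s : Step V) : Prop :=
  match s.hs, s.ht with
  | false, false => G.line s.src s.tgt
  | false, true  => G.arrow s.src s.tgt
  | true,  false => G.arrow s.tgt s.src
  | true,  true  => G.arc s.src s.tgt

/-- `w` is a path from `i` to `j` in `G`: a nonempty chained list of valid
steps with no repeated nodes. -/
def IsPath (G : MixedGraph V) (i j : V) (w : List (Step V)) : Prop :=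
  w ≠ [] ∧ (∀ s ∈ w, s.valid G) ∧ List.Chain' (fun a b => a.tgt = b.src) w ∧
    w.head?.map Step.src = some i ∧ w.getLast?.map Step.tgt = some j ∧
    (i :: w.map Step.tgt).Nodup

/-- The path `w` is m-connecting given `M` and `C`: every inner collider node
is in `C ∪ an(C)` and every inner non-collider node is in `M`. -/
def MConnPath (G : MixedGraph V) (M C : Set V) (w : List (Step V)) : Prop :=
  List.Chain'
    (fun a b =>
      (a.ht = true ∧ b.hs = true → a.tgt ∈ C ∪ G.anSet C) ∧
      (¬ (a.ht = true ∧ b.hs = true) → a.tgt ∈ M)) w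

/-- `A ⊥_m B | C` in `G` : there is no m-connecting path between `A` and `B`
given `C` (with `M` the remaining nodes). -/
def MSep (G : MixedGraph V) (A B C : Set V) : Prop :=
  ∀ i ∈ A, ∀ j ∈ B, ∀ w : List (Step V),
    IsPath G i j w → ¬ MConnPath G (G.nodes \ (A ∪ B ∪ C)) C w

/-- The independence model induced by `G` via m-separation: the set of
triples `⟨A,B|C⟩` of pairwise disjoint subsets of the nodes with
`A ⊥_m B | C`. -/
def Jm (G : MixedGraph V) : Set (Set V × Set V × Set V) :=
  {t | t.1 ⊆ G.nodes ∧ t.2.1 ⊆ G.nodes ∧ t.2.2 ⊆ G.nodes ∧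
    Disjoint t.1 t.2.1 ∧ Disjoint t.1 t.2.2 ∧ Disjoint t.2.1 t.2.2 ∧
    MSep G t.1 t.2.1 t.2.2}

/-- The independence model after marginalisation over `M` and conditioning on
`C` : `α(J;M,C)`. -/
def alphaIM (J : Set (Set V × Set V × Set V)) (M C : Set V) :
    Set (Set V × Set V × Set V) :=
  {t | (t.1, t.2.1, t.2.2 ∪ C) ∈ J ∧ (t.1 ∪ t.2.1 ∪ t.2.2) ∩ (M ∪ C) = ∅}

/-! ### Edges with explicit endpoint marks

An edge between `a` and `b` is described by two Booleans, which say whether it has an arrowhead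
at `a` and at `b`. -/

/-- `H` has an edge between `a` and `b` with arrowheads as prescribed by the two marks. -/
def Edge (H : MixedGraph V) (a : V) : Bool → V → Bool → Prop
  | false, b, false => H.line a b
  | false, b, true => H.arrow a b
  | true, b, false => H.arrow b a
  | true, b, true => H.arc a b

/-- The closure has an edge between `a` and `b` with arrowheads as prescribed by the two marks. -/
def GenEdge (H : MixedGraph V) (M S : Set V) (a : V) : Bool → V → Bool → Prop
  | false, b, false => GenLine H M S a b
  | false, b, true => GenArrow H M S a b
  | true, b, false => GenArrow H M S b a
  | true, b, true => GenArc H M S a b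

/-- The inner node `m` with marks `β`, `γ` is a collider in `S` or a non-collider in `M`. -/
def Passes (M S : Set V) (β : Bool) (m : V) (γ : Bool) : Prop :=
  (β = true ∧ γ = true ∧ m ∈ S) ∨ ((β = false ∨ γ = false) ∧ m ∈ M)

section Marks

variable {H : MixedGraph V} {M S : Set V}

theorem Edge.symm (hW : H.Wf) {a b : V} {α β : Bool} (h : Edge H a α b β) : Edge H b β a α := by
  cases α <;> cases β <;> simp only [Edge] at h ⊢
  · exact hW.2.1 _ _ h
  · exact h
  · exact h
  · exact hW.1 _ _ h

theorem Edge.ne (hL : H.Loopless) {a b : V} {α β : Bool} (h : Edge H a α b β) : a ≠ b := by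
  rintro rfl
  obtain ⟨h1, h2, h3⟩ := hL a
  cases α <;> cases β <;> simp only [Edge] at h <;> contradiction

theorem Edge.gen {a b : V} {α β : Bool} (h : Edge H a α b β) : GenEdge H M S a α b β := by
  cases α <;> cases β <;> simp only [Edge, GenEdge] at h ⊢
  · exact .base h
  · exact .base h
  · exact .base h
  · exact .base h

theorem GenEdge.symm {a b : V} {α β : Bool} (h : GenEdge H M S a α b β) :
    GenEdge H M S b β a α := by
  cases α <;> cases β <;> simp only [GenEdge] at h ⊢
  · exact .symm h
  · exact h
  · exact h
  · exact .symm h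

theorem GenEdge.comp {a m b : V} {α β γ δ : Bool} (h₁ : GenEdge H M S a α m β)
    (h₂ : GenEdge H M S m γ b δ) (hab : a ≠ b) (hm : Passes M S β m γ) :
    GenEdge H M S a α b δ := by
  rcases hm with ⟨rfl, rfl, hm⟩ | ⟨hβγ, hm⟩
  · cases α <;> cases δ <;> simp only [GenEdge] at h₁ h₂ ⊢
    · exact .row10 hm hab h₁ h₂
    · exact .row8 hm hab h₁ h₂
    · exact .row8 hm hab.symm h₂ (.symm h₁)
    · exact .row9 hm hab h₁ h₂
  · cases α <;> cases β <;> cases γ <;> cases δ <;> simp only [GenEdge] at h₁ h₂ ⊢ <;>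
      first
      | (exfalso; simp at hβγ; done)
      | exact .row1 hm hab h₁ h₂
      | exact .row1 hm hab.symm h₂ h₁
      | exact .row2 hm hab h₁ h₂
      | exact .row2 hm hab.symm (.symm h₂) h₁
      | exact .row3 hm hab h₁ h₂
      | exact .row3 hm hab.symm (.symm h₂) (.symm h₁)
      | exact .row4 hm hab h₁ h₂
      | exact .row5 hm hab h₁ h₂
      | exact .symm (.row5 hm hab.symm h₂ (.symm h₁))
      | exact .row6 hm hab h₁ h₂
      | exact .symm (.row6 hm hab.symm (.symm h₂) h₁)
      | exact .row7 hm hab h₁ h₂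

/-- The closure is contained in every symmetric relation on marked pairs of nodes which contains
the edges of `H` and is closed under composition at the permitted inner nodes. -/
theorem GenEdge.induction {R : V → Bool → V → Bool → Prop}
    (base : ∀ a α b β, Edge H a α b β → R a α b β)
    (symm : ∀ a α b β, R a α b β → R b β a α)
    (comp : ∀ a α m β γ b δ, R a α m β → R m γ b δ → a ≠ b → Passes M S β m γ → R a α b δ)
    {a b : V} {α β : Bool} (h : GenEdge H M S a α b β) : R a α b β := by
  have key : (∀ a b, GenArrow H M S a b → R a false b true) ∧
      (∀ a b, GenArc H M S a b → R a true b true) ∧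
      (∀ a b, GenLine H M S a b → R a false b false) := by
    refine ⟨?_, ?_, ?_⟩ <;> intro a b h
    on_goal 1 =>
      refine GenArrow.rec (motive_1 := fun a b _ => R a false b true)
        (motive_2 := fun a b _ => R a true b true) (motive_3 := fun a b _ => R a false b false)
        ?_ ?_ ?_ ?_ ?_ ?_ ?_ ?_ ?_ ?_ ?_ ?_ ?_ ?_ ?_ h
    on_goal 16 =>
      refine GenArc.rec (motive_1 := fun a b _ => R a false b true)
        (motive_2 := fun a b _ => R a true b true) (motive_3 := fun a b _ => R a false b false)
        ?_ ?_ ?_ ?_ ?_ ?_ ?_ ?_ ?_ ?_ ?_ ?_ ?_ ?_ ?_ h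
    on_goal 31 =>
      refine GenLine.rec (motive_1 := fun a b _ => R a false b true)
        (motive_2 := fun a b _ => R a true b true) (motive_3 := fun a b _ => R a false b false)
        ?_ ?_ ?_ ?_ ?_ ?_ ?_ ?_ ?_ ?_ ?_ ?_ ?_ ?_ ?_ h
    all_goals
      intros
      first
      | exact base _ _ _ _ ‹_›
      | exact symm _ _ _ _ ‹_›
      | exact comp _ _ _ _ _ _ _ ‹_› ‹_› ‹_› (.inl ⟨rfl, rfl, ‹_›⟩)
      | exact comp _ _ _ _ _ _ _ (symm _ _ _ _ ‹_›) ‹_› ‹_› (.inr ⟨by simp, ‹_›⟩)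
      | exact comp _ _ _ _ _ _ _ ‹_› ‹_› ‹_› (.inr ⟨by simp, ‹_›⟩)
      | exact comp _ _ _ _ _ _ _ ‹_› (symm _ _ _ _ ‹_›) ‹_› (.inl ⟨rfl, rfl, ‹_›⟩)
      | exact comp _ _ _ _ _ _ _ ‹_› (symm _ _ _ _ ‹_›) ‹_› (.inr ⟨by simp, ‹_›⟩)
  cases α <;> cases β
  · exact key.2.2 _ _ h
  · exact key.1 _ _ h
  · exact symm _ _ _ _ (key.1 _ _ h)
  · exact key.2.1 _ _ h

end Marks

/-! ### Ancestors of `S` and ribbon tails -/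

section Tails

variable {H : MixedGraph V} {M S : Set V}

theorem RibbonTail.of_anc {a b : V} (hb : H.RibbonTail b) (hab : H.anc a b) :
    H.RibbonTail a := by
  obtain ⟨d, hd, ht⟩ := hb
  refine ⟨d, .inr ?_, ht⟩
  rcases hd with rfl | hd
  · exact hab
  · exact Relation.TransGen.trans hab hd

theorem mem_of_anc (hS : ∀ a b, H.arrow a b → b ∈ S → a ∈ S) {a b : V} (hab : H.anc a b)
    (hb : b ∈ S) : a ∈ S := by
  induction hab using Relation.TransGen.head_induction_on with
  | single h => exact hS _ _ h hb
  | head h _ ih => exact hS _ _ h ih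

theorem mem_or_ribbonTail_of_anc (hS : ∀ a b, H.arrow a b → b ∈ S → a ∈ S) {a b : V}
    (hab : H.anc a b) (hb : b ∈ S ∨ H.RibbonTail b) : a ∈ S ∨ H.RibbonTail a :=
  hb.imp (mem_of_anc hS hab) (fun h => RibbonTail.of_anc h hab)

/-- A node with a tail in the closure is in `S`, has a ribbon tail in `H`, or is an ancestor in
`H` of the other endpoint. -/
theorem GenEdge.tail (hW : H.Wf) (hS : ∀ a b, H.arrow a b → b ∈ S → a ∈ S) {a b : V}
    {α β : Bool} (h : GenEdge H M S a α b β) :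
    (α = false → (a ∈ S ∨ H.RibbonTail a) ∨ (β = true ∧ H.anc a b)) ∧
    (β = false → (b ∈ S ∨ H.RibbonTail b) ∨ (α = true ∧ H.anc b a)) := by
  have comp : ∀ a m (β γ : Bool) b (δ : Bool),
      ((a ∈ S ∨ H.RibbonTail a) ∨ (β = true ∧ H.anc a m)) →
      (γ = false → (m ∈ S ∨ H.RibbonTail m) ∨ (δ = true ∧ H.anc m b)) →
      Passes M S β m γ → (a ∈ S ∨ H.RibbonTail a) ∨ (δ = true ∧ H.anc a b) := by
    rintro a m β γ b δ (ha | ⟨rfl, ha⟩) hm hp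
    · exact .inl ha
    · rcases hp with ⟨-, -, hmS⟩ | ⟨hγ, -⟩
      · exact .inl (.inl (mem_of_anc hS ha hmS))
      · rcases hm (by simpa using hγ) with hm | ⟨hδ, hm⟩
        · exact .inl (mem_or_ribbonTail_of_anc hS ha hm)
        · exact .inr ⟨hδ, Relation.TransGen.trans ha hm⟩
  have swap : ∀ {β γ : Bool} {m : V}, Passes M S β m γ → Passes M S γ m β := by
    rintro β γ m (⟨h₁, h₂, h₃⟩ | ⟨h₁, h₂⟩)
    · exact .inl ⟨h₂, h₁, h₃⟩
    · exact .inr ⟨h₁.symm, h₂⟩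
  refine GenEdge.induction (R := fun a α b β =>
    (α = false → (a ∈ S ∨ H.RibbonTail a) ∨ (β = true ∧ H.anc a b)) ∧
    (β = false → (b ∈ S ∨ H.RibbonTail b) ∨ (α = true ∧ H.anc b a))) ?_ ?_ ?_ h
  · have one : ∀ a b β, Edge H a false b β →
        (a ∈ S ∨ H.RibbonTail a) ∨ (β = true ∧ H.anc a b) := by
      intro a b β h
      cases β
      · exact .inl (.inr ⟨a, .inl rfl, .inl ⟨b, h⟩⟩)
      · exact .inr ⟨rfl, .single h⟩
    intro a α b β h
    exact ⟨by rintro rfl; exact one _ _ _ h, by rintro rfl; exact one _ _ _ (h.symm hW)⟩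
  · intro a α b β h
    exact ⟨h.2, h.1⟩
  · intro a α m β γ b δ h₁ h₂ _ hp
    exact ⟨fun hα => comp _ _ _ _ _ _ (h₁.1 hα) h₂.1 hp,
      fun hδ => comp _ _ _ _ _ _ (h₂.2 hδ) h₁.2 (swap hp)⟩

theorem GenEdge.ne (hL : H.Loopless) {a b : V} {α β : Bool} (h : GenEdge H M S a α b β) :
    a ≠ b :=
  GenEdge.induction (R := fun a _ b _ => a ≠ b) (fun _ _ _ _ h => h.ne hL)
    (fun _ _ _ _ h => h.symm) (fun _ _ _ _ _ _ _ _ _ h _ => h) h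

end Tails

/-! ### Closing the colliders in an ancestral set -/

section ColliderClosure

variable {H : MixedGraph V} {M S : Set V}

/-- Connection by arcs inside `S`. -/
def ArcConn (H : MixedGraph V) (S : Set V) : V → V → Prop :=
  Relation.ReflTransGen fun x y => x ∈ S ∧ y ∈ S ∧ H.arc x y

/-- `a` has an edge, with mark `α` at `a`, which points into the arc-component of `q` in `S`. -/
def PointsInto (H : MixedGraph V) (S : Set V) (a : V) (α : Bool) (q : V) : Prop :=
  ∃ c ∈ S, Edge H a α c true ∧ ArcConn H S c q

/-- An edge of `H`, or an edge generated by a collider path in `S` with an inner node that differs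
from both endpoints. -/
def ColliderEdge (H : MixedGraph V) (S : Set V) (a : V) (α : Bool) (b : V) (β : Bool) : Prop :=
  Edge H a α b β ∨
    (a ≠ b ∧ ∃ y ∈ S, y ≠ a ∧ y ≠ b ∧ PointsInto H S a α y ∧ PointsInto H S b β y)

theorem ArcConn.symm (hW : H.Wf) {x y : V} (h : ArcConn H S x y) : ArcConn H S y x := by
  induction h with
  | refl => exact .refl
  | tail _ h ih => exact .head ⟨h.2.1, h.1, hW.1 _ _ h.2.2⟩ ih

theorem ArcConn.mem {x y : V} (h : ArcConn H S x y) (hx : x ∈ S) : y ∈ S := by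
  induction h with
  | refl => exact hx
  | tail _ h _ => exact h.2.1

theorem PointsInto.mem {a q : V} {α : Bool} (h : PointsInto H S a α q) : q ∈ S := by
  obtain ⟨c, hc, -, hq⟩ := h
  exact hq.mem hc

theorem PointsInto.trans {a q r : V} {α : Bool} (h : PointsInto H S a α q)
    (hr : ArcConn H S q r) : PointsInto H S a α r := by
  obtain ⟨c, hc, he, hq⟩ := h
  exact ⟨c, hc, he, Relation.ReflTransGen.trans hq hr⟩

theorem PointsInto.arcConn (hW : H.Wf) {i q : V} (h : PointsInto H S i true q) (hi : i ∈ S) :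
    ArcConn H S q i := by
  obtain ⟨c, hc, he, hq⟩ := h
  exact (hq.symm hW).tail ⟨hc, hi, hW.1 _ _ he⟩

theorem ArcConn.gen {y x : V} (hy : y ∈ S) (h : ArcConn H S y x) :
    x = y ∨ GenEdge H M S y true x true := by
  induction h with
  | refl => exact .inl rfl
  | @tail x z _ h ih =>
    by_cases hz : z = y
    · exact .inl hz
    · right
      have he : GenEdge H M S x true z true := Edge.gen (α := true) (β := true) h.2.2
      rcases ih with rfl | ih
      · exact he
      · exact ih.comp he (Ne.symm hz) (.inl ⟨rfl, rfl, h.1⟩)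

theorem PointsInto.gen (hW : H.Wf) {a y : V} {α : Bool} (h : PointsInto H S a α y) (hay : a ≠ y) :
    GenEdge H M S a α y true := by
  have hy := h.mem
  obtain ⟨c, hc, he, hq⟩ := h
  rcases (hq.symm hW).gen (M := M) hy with rfl | h
  · exact he.gen
  · exact he.gen.comp h.symm hay (.inl ⟨rfl, rfl, hc⟩)

theorem ColliderEdge.gen (hW : H.Wf) {a b : V} {α β : Bool} (h : ColliderEdge H S a α b β) :
    GenEdge H M S a α b β := by
  rcases h with h | ⟨hab, y, hy, hya, hyb, ha, hb⟩
  · exact h.gen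
  · exact (ha.gen hW hya.symm).comp (hb.gen hW hyb.symm).symm hab (.inl ⟨rfl, rfl, hy⟩)

theorem ColliderEdge.symm (hW : H.Wf) {a b : V} {α β : Bool} (h : ColliderEdge H S a α b β) :
    ColliderEdge H S b β a α := by
  rcases h with h | ⟨hab, y, hy, hya, hyb, ha, hb⟩
  · exact .inl (h.symm hW)
  · exact .inr ⟨hab.symm, y, hy, hyb, hya, hb, ha⟩

theorem ColliderEdge.ne (hL : H.Loopless) {a b : V} {α β : Bool} (h : ColliderEdge H S a α b β) :
    a ≠ b := by
  rcases h with h | h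
  · exact h.ne hL
  · exact h.1

theorem ColliderEdge.pointsInto (hW : H.Wf) {a i : V} {α : Bool}
    (h : ColliderEdge H S a α i true) (hi : i ∈ S) : PointsInto H S a α i := by
  rcases h with h | ⟨-, y, -, -, -, ha, hb⟩
  · exact ⟨i, hi, h, .refl⟩
  · exact ha.trans (hb.arcConn hW hi)

/-- A collider path in `S` between distinct nodes generates an edge, unless its inner nodes are
its endpoints. -/
theorem PointsInto.colliderEdge_or (hW : H.Wf) (hL : H.Loopless) {a b q : V} {α β : Bool}
    (ha : PointsInto H S a α q) (hb : PointsInto H S b β q) (hab : a ≠ b) :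
    ColliderEdge H S a α b β ∨ (α = false ∧ β = false ∧ H.arrow a b ∧ H.arrow b a ∧ H.arc a b ∧
      ∀ c, ArcConn H S c q → c = a ∨ c = b) := by
  by_cases hq : ∃ y, ArcConn H S q y ∧ y ≠ a ∧ y ≠ b
  · obtain ⟨y, hy, hya, hyb⟩ := hq
    exact .inl (.inr ⟨hab, y, hy.mem ha.mem, hya, hyb, ha.trans hy, hb.trans hy⟩)
  · have hq' : ∀ c, ArcConn H S c q → c = a ∨ c = b := by
      intro c hc
      by_contra hne
      rw [not_or] at hne
      exact hq ⟨c, hc.symm hW, hne.1, hne.2⟩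
    obtain ⟨c, hcS, hac, hcq⟩ := ha
    obtain ⟨d, hdS, hbd, hdq⟩ := hb
    obtain rfl : c = b := (hq' c hcq).resolve_left (hac.ne hL).symm
    obtain rfl : d = a := (hq' d hdq).resolve_right (hbd.ne hL).symm
    cases β
    · cases α
      · refine .inr ⟨rfl, rfl, hac, hbd, ?_, hq'⟩
        have hconn : ArcConn H S d c := Relation.ReflTransGen.trans hdq (hcq.symm hW)
        rcases Relation.ReflTransGen.cases_head hconn with h | ⟨e, he, hec⟩
        · exact absurd h hab
        · rcases hq' e (Relation.ReflTransGen.trans hec hcq) with rfl | rfl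
          · exact absurd he.2.2 (hL e).2.1
          · exact he.2.2
      · exact .inl (.inl (hbd.symm hW))
    · exact .inl (.inl hac)

/-- Colliders with a ribbon tail are closed in a ribbonless graph. -/
theorem Edge.comp_of_ribbonTail (hH : H.IsRG) {h i j : V} {α β : Bool} (hi : H.RibbonTail i)
    (h₁ : Edge H h α i true) (h₂ : Edge H j β i true) (hhj : h ≠ j) : Edge H h α j β := by
  have hW := hH.1.1
  have hhi := h₁.ne hH.1.2.1
  have hji := h₂.ne hH.1.2.1
  by_contra hne
  refine hH.2 ?_
  cases α <;> cases β <;> simp only [Edge] at h₁ h₂ hne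
  · exact ⟨h, i, j, hhi, hji.symm, hhj, hi, .inr (.inl ⟨h₁, h₂, hne⟩)⟩
  · exact ⟨h, i, j, hhi, hji.symm, hhj, hi, .inr (.inr ⟨h₁, hW.1 _ _ h₂, hne⟩)⟩
  · exact ⟨j, i, h, hji, hhi.symm, hhj.symm, hi, .inr (.inr ⟨h₂, hW.1 _ _ h₁, hne⟩)⟩
  · exact ⟨h, i, j, hhi, hji.symm, hhj, hi, .inl ⟨h₁, hW.1 _ _ h₂, hne⟩⟩

theorem line_of_two_cycle (hH : H.IsRG) {h i j : V} (hi : H.RibbonTail i) (hhj : H.arrow h j)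
    (hjh : H.arrow j h) (ha : H.arc h j) (hhi : H.arc h i) (hij : i ≠ j) : H.line h j := by
  have hne : h ≠ j := fun e => (hH.1.2.1 j).1 (e ▸ hhj)
  have hc : H.RibbonTail h := ⟨h, .inl rfl, .inr (.head hhj (.single hjh))⟩
  have hc' : H.RibbonTail j := ⟨j, .inl rfl, .inr (.head hjh (.single hhj))⟩
  have hih : Edge H i true h true := hH.1.1.1 _ _ hhi
  have hji : Edge H j false i true :=
    Edge.comp_of_ribbonTail hH hc (α := false) (β := true) hjh hih hij.symm
  have hij' : Edge H i true j true :=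
    Edge.comp_of_ribbonTail hH hc (α := true) (β := true) hih (hH.1.1.1 _ _ ha) hij
  have hhi' : Edge H h false i true :=
    Edge.comp_of_ribbonTail hH hc' (α := false) (β := true) hhj hij' (Edge.ne hH.1.2.1 hih).symm
  exact Edge.comp_of_ribbonTail hH hi hhi' hji hne

theorem PointsInto.colliderEdge_of_ribbonTail (hH : H.IsRG) {h i j c : V} {α β : Bool}
    (hi : H.RibbonTail i) (hih : i ≠ h) (hij : i ≠ j) (ha : PointsInto H S h α c)
    (hb : PointsInto H S j β c) (hci : H.arc c i) (hhj : h ≠ j) : ColliderEdge H S h α j β := by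
  rcases ha.colliderEdge_or hH.1.1 hH.1.2.1 hb hhj with h | ⟨rfl, rfl, h₁, h₂, h₃, hq⟩
  · exact h
  · refine .inl ?_
    rcases hq c .refl with rfl | rfl
    · exact line_of_two_cycle hH hi h₁ h₂ h₃ hci hij
    · exact hH.1.1.2.1 _ _ (line_of_two_cycle hH hi h₂ h₁ (hH.1.1.1 _ _ h₃) hci hih)

theorem PointsInto.colliderEdge_of_edge (hH : H.IsRG) {h i j c : V} {α β : Bool}
    (hi : H.RibbonTail i) (hiS : i ∉ S) (hij : i ≠ j) (ha : Edge H h α i true)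
    (hb : PointsInto H S j β c) (hci : H.arc c i) (hhj : h ≠ j) : ColliderEdge H S h α j β := by
  have hW := hH.1.1
  have hih := (ha.ne hH.1.2.1).symm
  have hic : Edge H i true c true := hW.1 _ _ hci
  by_cases hch : c = h
  · subst hch
    obtain ⟨d, hd, he, hq⟩ := hb
    rcases Relation.ReflTransGen.cases_tail hq with h | ⟨e, hde, he'⟩
    · subst h
      cases α
      · have hc : H.RibbonTail c := RibbonTail.of_anc hi (.single ha)
        have hji := Edge.comp_of_ribbonTail hH hc he hic hij.symm
        exact .inl (Edge.comp_of_ribbonTail hH hi ha hji hhj)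
      · exact .inl (he.symm hW)
    · have hj : PointsInto H S j β e := ⟨d, hd, he, hde⟩
      cases α
      · have hc : H.RibbonTail c := RibbonTail.of_anc hi (.single ha)
        have hei : Edge H e true i true :=
          Edge.comp_of_ribbonTail hH hc (α := true) (β := true) he'.2.2 hic
            (fun h => hiS (h ▸ he'.1))
        have hce : Edge H c false e true :=
          Edge.comp_of_ribbonTail hH hi ha hei (fun h => (hH.1.2.1 c).2.1 (h ▸ he'.2.2))
        exact PointsInto.colliderEdge_of_ribbonTail hH hi hih hij ⟨e, he'.1, hce, .refl⟩ hj hei hhj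
      · have hce : Edge H c true e true := hW.1 _ _ he'.2.2
        rcases PointsInto.colliderEdge_or hW hH.1.2.1 ⟨e, he'.1, hce, .refl⟩ hj hhj with h | h
        · exact h
        · exact absurd h.1 (by simp)
  · have hhc : Edge H h α c true := Edge.comp_of_ribbonTail hH hi ha hci (Ne.symm hch)
    exact PointsInto.colliderEdge_of_ribbonTail hH hi hih hij ⟨c, hb.mem, hhc, .refl⟩ hb hci hhj

/-- Colliders which are in `S` or have a ribbon tail are closed for collider edges. -/
theorem ColliderEdge.comp (hH : H.IsRG) {h i j : V} {α β : Bool} (hi : i ∈ S ∨ H.RibbonTail i)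
    (h₁ : ColliderEdge H S h α i true) (h₂ : ColliderEdge H S j β i true) (hhj : h ≠ j) :
    ColliderEdge H S h α j β := by
  have hW := hH.1.1
  have hih := (h₁.ne hH.1.2.1).symm
  have hij := (h₂.ne hH.1.2.1).symm
  by_cases hiS : i ∈ S
  · exact .inr ⟨hhj, i, hiS, hih, hij, h₁.pointsInto hW hiS, h₂.pointsInto hW hiS⟩
  have hi := hi.resolve_left hiS
  have arc : ∀ {a : V} {γ : Bool}, ColliderEdge H S a γ i true →
      Edge H a γ i true ∨ ∃ c, PointsInto H S a γ c ∧ H.arc c i := by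
    rintro a γ (h | ⟨-, y, -, -, -, ha, c, hc, he, hq⟩)
    · exact .inl h
    · exact .inr ⟨c, ha.trans (hq.symm hW), hW.1 _ _ he⟩
  rcases arc h₁ with h₁ | ⟨c, h₁, hc⟩ <;> rcases arc h₂ with h₂ | ⟨d, h₂, hd⟩
  · exact .inl (Edge.comp_of_ribbonTail hH hi h₁ h₂ hhj)
  · exact PointsInto.colliderEdge_of_edge hH hi hiS hij h₁ h₂ hd hhj
  · exact (PointsInto.colliderEdge_of_edge hH hi hiS hih h₂ h₁ hc hhj.symm).symm hW
  · refine PointsInto.colliderEdge_of_ribbonTail hH hi hih hij (h₁.trans ?_) h₂ hd hhj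
    by_cases hcd : c = d
    · exact hcd ▸ .refl
    · exact .single ⟨h₁.mem, h₂.mem,
        Edge.comp_of_ribbonTail hH hi (α := true) (β := true) hc hd hcd⟩

theorem ColliderEdge.mem_of_arrow (hS : ∀ a b, H.arrow a b → b ∈ S → a ∈ S) {a b : V}
    (h : ColliderEdge H S a false b true) (hb : b ∈ S ∨ H.RibbonTail b) :
    a ∈ S ∨ H.RibbonTail a := by
  rcases h with h | ⟨-, y, -, -, -, ⟨c, hc, he, -⟩, -⟩
  · exact mem_or_ribbonTail_of_anc hS (.single h) hb
  · exact .inl (hS _ _ he hc)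

end ColliderClosure

/-! ### Walks with non-collider inner nodes -/

section Walks

variable {E : V → Bool → V → Bool → Prop} {M A : Set V}

/-- Walks of a given length with edges in `E`, all of whose inner nodes are non-colliders
in `M`. -/
inductive NonColliderWalk (E : V → Bool → V → Bool → Prop) (M : Set V) :
    V → Bool → V → Bool → ℕ → Prop
  | single {a b : V} {α β : Bool} : E a α b β → NonColliderWalk E M a α b β 1
  | snoc {a n b : V} {α β γ δ : Bool} {k : ℕ} : NonColliderWalk E M a α n β k → n ∈ M →
      (β = false ∨ γ = false) → E n γ b δ → NonColliderWalk E M a α b δ (k + 1)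

theorem NonColliderWalk.append {a n b : V} {α β γ δ : Bool} {k l : ℕ}
    (h₁ : NonColliderWalk E M a α n β k) (hn : n ∈ M) (hβγ : β = false ∨ γ = false)
    (h₂ : NonColliderWalk E M n γ b δ l) : NonColliderWalk E M a α b δ (k + l) := by
  induction h₂ with
  | single h => exact .snoc h₁ hn hβγ h
  | snoc _ hm hm' he ih => exact .snoc (ih hβγ) hm hm' he

theorem NonColliderWalk.reverse (hE : ∀ a α b β, E a α b β → E b β a α) {a b : V} {α β : Bool}
    {k : ℕ} (h : NonColliderWalk E M a α b β k) : ∃ l, NonColliderWalk E M b β a α l := by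
  induction h with
  | single h => exact ⟨1, .single (hE _ _ _ _ h)⟩
  | snoc _ hn hβγ he ih =>
    obtain ⟨l, hl⟩ := ih
    exact ⟨1 + l, (NonColliderWalk.single (hE _ _ _ _ he)).append hn hβγ.symm hl⟩

/-- The mark `α` at the end `a` of a generated edge may be replaced by the mark `α'`. -/
def MarkChange (M A : Set V) (a : V) (α α' : Bool) : Prop :=
  α' = α ∨ (a ∈ M ∧ (α' = false ∨ a ∈ A))

/-- There is a walk from `a` to `b` with non-collider inner nodes in `M`, having the given marks up
to a permitted change at endpoints in `M`. -/
def WalkConn (E : V → Bool → V → Bool → Prop) (M A : Set V) (a : V) (α : Bool) (b : V)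
    (β : Bool) : Prop :=
  ∃ α' β' k, NonColliderWalk E M a α' b β' k ∧ MarkChange M A a α α' ∧ MarkChange M A b β β'

theorem NonColliderWalk.walkConn {a b : V} {α β : Bool} {k : ℕ}
    (h : NonColliderWalk E M a α b β k) : WalkConn E M A a α b β :=
  ⟨α, β, k, h, .inl rfl, .inl rfl⟩

theorem WalkConn.symm (hE : ∀ a α b β, E a α b β → E b β a α) {a b : V} {α β : Bool}
    (h : WalkConn E M A a α b β) : WalkConn E M A b β a α := by
  obtain ⟨α', β', k, h, hα, hβ⟩ := h
  obtain ⟨l, hl⟩ := h.reverse hE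
  exact ⟨β', α', l, hl, hβ, hα⟩

theorem MarkChange.trans {a : V} {α α' α'' : Bool} (h₁ : MarkChange M A a α α')
    (h₂ : MarkChange M A a α' α'') : MarkChange M A a α α'' := by
  rcases h₂ with rfl | h₂
  · exact h₁
  · exact .inr h₂

/-- Two walks meeting head to head at a node of `A` can be joined. -/
theorem NonColliderWalk.join (hE : ∀ a α b β, E a α b β → E b β a α)
    (hA : ∀ a α i b β, i ∈ A → E a α i true → E b β i true → a ≠ b → E a α b β)
    (hA' : ∀ a b, E a false b true → b ∈ A → a ∈ A) {a i b : V} {α β : Bool} {k l : ℕ}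
    (h₁ : NonColliderWalk E M a α i true k) (h₂ : NonColliderWalk E M b β i true l)
    (hi : i ∈ A) (hab : a ≠ b) : WalkConn E M A a α b β := by
  induction k using Nat.strong_induction_on generalizing i l with
  | _ k ih =>
  have one : ∀ {a b : V} {α β : Bool} {l : ℕ}, E a α i true →
      NonColliderWalk E M b β i true l → a ≠ b → WalkConn E M A a α b β := by
    intro a b α β l h₁ h₂ hab
    cases h₂ with
    | single h₂ => exact (NonColliderWalk.single (hA _ _ _ _ _ hi h₁ h₂ hab)).walkConn
    | @snoc n _ _ β' γ _ _ h₂ hn hγ he =>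
      by_cases hna : n = a
      · subst hna
        obtain ⟨l, hl⟩ := h₂.reverse hE
        refine ⟨β', β, l, hl, .inr ⟨hn, ?_⟩, .inl rfl⟩
        rcases hγ with hγ | rfl
        · exact .inl hγ
        · exact .inr (hA' _ _ he hi)
      · obtain ⟨l, hl⟩ := h₂.reverse hE
        exact ((NonColliderWalk.single (hA _ _ _ _ _ hi h₁ he (Ne.symm hna))).append hn
          hγ.symm hl).walkConn
  cases h₁ with
  | single h₁ => exact one h₁ h₂ hab
  | @snoc n _ _ β₁ γ₁ _ k h₁ hn hγ he =>
    cases h₂ with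
    | single h₂ =>
      exact (one h₂ (.snoc h₁ hn hγ he) hab.symm).symm hE
    | @snoc n' _ _ β₂ γ₂ _ l h₂ hn' hγ' he' =>
      obtain ⟨l', hl⟩ := h₂.reverse hE
      by_cases hnn : n = n'
      · subst hnn
        by_cases hβ : β₁ = false ∨ β₂ = false
        · exact (h₁.append hn hβ hl).walkConn
        · simp only [not_or, Bool.not_eq_false] at hβ
          obtain ⟨rfl, rfl⟩ := hβ
          obtain rfl : γ₁ = false := by simpa using hγ
          exact ih k (Nat.lt_succ_self k) h₁ h₂ (hA' _ _ he hi)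
      · exact ((h₁.snoc hn hγ (hA _ _ _ _ _ hi he he' hnn)).append hn' hγ'.symm hl).walkConn

theorem WalkConn.comp (hE : ∀ a α b β, E a α b β → E b β a α)
    (hA : ∀ a α i b β, i ∈ A → E a α i true → E b β i true → a ≠ b → E a α b β)
    (hA' : ∀ a b, E a false b true → b ∈ A → a ∈ A) {a m b : V} {α β γ δ : Bool}
    (h₁ : WalkConn E M A a α m β) (h₂ : WalkConn E M A m γ b δ) (hab : a ≠ b)
    (hm : Passes M A β m γ) : WalkConn E M A a α b δ := by
  obtain ⟨α', β', k, h₁, hα, hβ⟩ := h₁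
  obtain ⟨γ', δ', l, h₂, hγ, hδ⟩ := h₂
  suffices h : WalkConn E M A a α' b δ' by
    obtain ⟨α'', δ'', n, h, hα', hδ'⟩ := h
    exact ⟨α'', δ'', n, h, hα.trans hα', hδ.trans hδ'⟩
  have hm' : Passes M A β' m γ' := by
    unfold Passes MarkChange at *
    cases β' <;> cases γ' <;> grind
  rcases hm' with ⟨rfl, rfl, hmA⟩ | ⟨hβγ, hmM⟩
  · obtain ⟨l', hl⟩ := h₂.reverse hE
    exact h₁.join hE hA hA' hl hmA hab
  · exact (h₁.append hmM hβγ h₂).walkConn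

end Walks

/-! ### The generated graph is ribbonless -/

section Generated

variable {H : MixedGraph V} {M S : Set V}

theorem NonColliderWalk.gen (hW : H.Wf) {a b : V} {α β : Bool} {k : ℕ}
    (h : NonColliderWalk (ColliderEdge H S) M a α b β k) (ha : a ∉ M) (hab : a ≠ b) :
    GenEdge H M S a α b β := by
  induction h with
  | single h => exact h.gen hW
  | snoc _ hn hβγ he ih =>
    exact (ih (fun h => ha (h ▸ hn))).comp (he.gen hW) hab (.inr ⟨hβγ, hn⟩)

/-- Colliders which are in `S` or have a ribbon tail in `H` are closed in the closure, for
endpoints outside `M`. -/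
theorem GenEdge.comp_of_ribbonTail (hH : H.IsRG) (hS : ∀ a b, H.arrow a b → b ∈ S → a ∈ S)
    {h i j : V} {α β : Bool} (hi : i ∈ S ∨ H.RibbonTail i) (h₁ : GenEdge H M S h α i true)
    (h₂ : GenEdge H M S j β i true) (hh : h ∉ M) (hj : j ∉ M) (hhj : h ≠ j) :
    GenEdge H M S h α j β := by
  have hW := hH.1.1
  set A : Set V := {x | x ∈ S ∨ H.RibbonTail x}
  have hE : ∀ a α b β, ColliderEdge H S a α b β → ColliderEdge H S b β a α :=
    fun _ _ _ _ h => h.symm hW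
  have hA : ∀ a α i b β, i ∈ A → ColliderEdge H S a α i true → ColliderEdge H S b β i true →
      a ≠ b → ColliderEdge H S a α b β := fun _ _ _ _ _ hi h₁ h₂ hab => h₁.comp hH hi h₂ hab
  have hA' : ∀ a b, ColliderEdge H S a false b true → b ∈ A → a ∈ A :=
    fun _ _ h hb => h.mem_of_arrow hS hb
  have walk : ∀ {a b : V} {α β : Bool}, GenEdge H M S a α b β →
      WalkConn (ColliderEdge H S) M A a α b β := by
    intro a b α β h
    refine GenEdge.induction (R := WalkConn (ColliderEdge H S) M A) ?_ ?_ ?_ h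
    · exact fun a α b β h => (NonColliderWalk.single (.inl h)).walkConn
    · exact fun a α b β h => h.symm hE
    · refine fun a α m β γ b δ h₁ h₂ hab hm => h₁.comp hE hA hA' h₂ hab ?_
      exact hm.imp (fun h => ⟨h.1, h.2.1, .inl h.2.2⟩) id
  obtain ⟨α', β', k, hw, hα, hβ⟩ :=
    (walk h₁).comp hE hA hA' ((walk h₂).symm hE) hhj (.inl ⟨rfl, rfl, hi⟩)
  obtain rfl : α' = α := hα.resolve_right fun h => hh h.1
  obtain rfl : β' = β := hβ.resolve_right fun h => hj h.1
  exact hw.gen hW hh hhj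

theorem alphaRG_edge_iff {M C : Set V} {a b : V} {α β : Bool} :
    Edge (alphaRG H M C) a α b β ↔ a ∈ H.nodes \ (M ∪ C) ∧ b ∈ H.nodes \ (M ∪ C) ∧
      GenEdge H M (C ∪ H.anSet C) a α b β := by
  cases α <;> cases β <;> simp only [Edge, GenEdge, alphaRG]
  exact and_left_comm

theorem mem_of_arrow_of_mem {C : Set V} (a b : V) (hab : H.arrow a b)
    (hb : b ∈ C ∪ H.anSet C) : a ∈ C ∪ H.anSet C := by
  rcases hb with hb | ⟨c, hc, hbc⟩
  · exact .inr ⟨b, hb, .single hab⟩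
  · exact .inr ⟨c, hc, .head hab hbc⟩

theorem RibbonTail.of_alphaRG (hW : H.Wf) {M C : Set V} {i : V}
    (hi : (alphaRG H M C).RibbonTail i) : i ∈ C ∪ H.anSet C ∨ H.RibbonTail i := by
  have anc : ∀ {a b : V}, (alphaRG H M C).anc a b →
      (a ∈ C ∪ H.anSet C ∨ H.RibbonTail a) ∨ H.anc a b := by
    intro a b h
    have step : ∀ {x y : V}, (alphaRG H M C).arrow x y →
        (x ∈ C ∪ H.anSet C ∨ H.RibbonTail x) ∨ H.anc x y := fun h =>
      ((GenEdge.tail hW mem_of_arrow_of_mem (α := false) (β := true) h.2.2).1 rfl).imp id And.right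
    induction h using Relation.TransGen.head_induction_on with
    | single h => exact step h
    | head h _ ih =>
      rcases step h with h | h
      · exact .inl h
      · rcases ih with ih | ih
        · exact .inl (mem_or_ribbonTail_of_anc mem_of_arrow_of_mem h ih)
        · exact .inr (Relation.TransGen.trans h ih)
  obtain ⟨d, hd, hd'⟩ := hi
  have hdA : d ∈ C ∪ H.anSet C ∨ H.RibbonTail d := by
    rcases hd' with ⟨e, he⟩ | hd'
    · exact ((GenEdge.tail hW mem_of_arrow_of_mem (α := false) (β := false) he.2.2).1
        rfl).resolve_right (by simp)
    · exact (anc hd').elim id fun h => .inr ⟨d, .inl rfl, .inr h⟩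
  rcases hd with rfl | hd
  · exact hdA
  · exact (anc hd).elim id fun h => mem_or_ribbonTail_of_anc mem_of_arrow_of_mem h hdA

theorem alphaRG_isLMG {M C : Set V} (hH : H.IsLMG) : (alphaRG H M C).IsLMG := by
  refine ⟨⟨fun i j h => ⟨h.2.1, h.1, .symm h.2.2⟩, fun i j h => ⟨h.2.1, h.1, .symm h.2.2⟩, ?_⟩,
    ?_, hH.2.2.subset Set.sdiff_subset⟩
  · rintro i j (h | h | h) <;> exact ⟨h.1, h.2.1⟩
  · intro i
    exact ⟨fun h => GenEdge.ne hH.2.1 (α := false) (β := true) h.2.2 rfl,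
      fun h => GenEdge.ne hH.2.1 (α := true) (β := true) h.2.2 rfl,
      fun h => GenEdge.ne hH.2.1 (α := false) (β := false) h.2.2 rfl⟩

end Generated

/-- (Proposition 1) For every ribbonless graph `H` and
disjoint subsets `M` and `C` of its node set, the generated graph
`α_RG(H;M,C)` is a ribbonless graph. -/
theorem stmt_1 {V : Type} (H : MixedGraph V) (M C : Set V)
    (hH : H.IsRG) (hM : M ⊆ H.nodes) (hC : C ⊆ H.nodes) (hMC : Disjoint M C) :
    (alphaRG H M C).IsRG := by
  refine ⟨alphaRG_isLMG hH.1, ?_⟩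
  rintro ⟨h, i, j, -, -, hhj, hi, hedge⟩
  have hi := RibbonTail.of_alphaRG hH.1.1 hi
  have hW := (alphaRG_isLMG (M := M) (C := C) hH.1).1
  have close : ∀ {α β : Bool}, Edge (alphaRG H M C) h α i true →
      Edge (alphaRG H M C) j β i true → Edge (alphaRG H M C) h α j β := by
    intro α β h₁ h₂
    rw [alphaRG_edge_iff] at h₁ h₂ ⊢
    exact ⟨h₁.1, h₂.1, h₁.2.2.comp_of_ribbonTail hH mem_of_arrow_of_mem hi h₂.2.2
      (fun h => h₁.1.2 (.inl h)) (fun h => h₂.1.2 (.inl h)) hhj⟩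
  rcases hedge with ⟨h₁, h₂, hne⟩ | ⟨h₁, h₂, hne⟩ | ⟨h₁, h₂, hne⟩
  · exact hne (close (α := true) (β := true) h₁ (hW.1 _ _ h₂))
  · exact hne (close (α := false) (β := false) h₁ h₂)
  · exact hne (close (α := false) (β := true) h₁ (hW.1 _ _ h₂))

end StableMixedGraphs
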